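/- arXiv:1810.12591 — 13 statements merged into one kernel-verified Lean document; each statement's English description precedes it below -/
import Mathlib

section
/- Let f, f', g, g' : X → Y be continuous maps between topological spaces. If f is homotopic to f' and g is homotopic to g', then D(f,g) = D(f',g'). -/
open ContinuousMap

/-- The homotopic distance between two continuous maps `f g : C(X, Y)`:
the least `n : ℕ∞` such that `X` admits an open cover by `n + 1` sets on each of
which the restrictions of `f` and `g` are homotopic; `⊤` if no such cover exists. -/
noncomputable def homotopicDistance {X Y : Type*} [TopologicalSpace X] [TopologicalSpace Y]
    (f g : C(X, Y)) : ℕ∞ :=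
  sInf ((Nat.cast : ℕ → ℕ∞) '' {n : ℕ | ∃ U : Fin (n + 1) → Set X,
    (∀ j, IsOpen (U j)) ∧ (⋃ j, U j) = Set.univ ∧
    ∀ j, (f.restrict (U j)).Homotopic (g.restrict (U j))})

/-- The (normalized) Lusternik–Schnirelmann category of a space `X`: the least
`n : ℕ∞` such that `X` admits an open cover by `n + 1` sets on each of which the
inclusion into `X` is null-homotopic. -/
noncomputable def lsCat (X : Type*) [TopologicalSpace X] : ℕ∞ :=
  sInf ((Nat.cast : ℕ → ℕ∞) '' {n : ℕ | ∃ U : Fin (n + 1) → Set X,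
    (∀ j, IsOpen (U j)) ∧ (⋃ j, U j) = Set.univ ∧
    ∀ j, ∃ y : X, ((ContinuousMap.id X).restrict (U j)).Homotopic
      (ContinuousMap.const (U j) y)})

theorem ContinuousMap.Homotopic.restrict {X Y : Type*} [TopologicalSpace X] [TopologicalSpace Y]
    {f g : C(X, Y)} (h : f.Homotopic g) (s : Set X) : (f.restrict s).Homotopic (g.restrict s) :=
  h.comp (.refl (ContinuousMap.mk Subtype.val continuous_subtype_val))

theorem ContinuousMap.Homotopic.restrict_homotopic_iff {X Y : Type*} [TopologicalSpace X]
    [TopologicalSpace Y] {f f' g g' : C(X, Y)} (hf : f.Homotopic f') (hg : g.Homotopic g')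
    (s : Set X) :
    (f.restrict s).Homotopic (g.restrict s) ↔ (f'.restrict s).Homotopic (g'.restrict s) :=
  ⟨fun h => ((hf.restrict s).symm.trans h).trans (hg.restrict s),
    fun h => ((hf.restrict s).trans h).trans (hg.restrict s).symm⟩

/-- the homotopic distance only depends on the homotopy classes of the maps. -/
theorem homotopicDistance_congr {X Y : Type*} [TopologicalSpace X] [TopologicalSpace Y]
    (f f' g g' : C(X, Y)) (hf : f.Homotopic f') (hg : g.Homotopic g') :
    homotopicDistance f g = homotopicDistance f' g' := by
  simp only [homotopicDistance, hf.restrict_homotopic_iff hg]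
end

section
/- (Sub-additivity) Let f, g : X → Y be continuous maps and let {U_0, …, U_n} be a finite open cover of X. Then D(f,g) ≤ Σ_{k=0}^n D(f|_{U_k}, g|_{U_k}) + n, where f|_{U_k}, g|_{U_k} : U_k → Y are the restrictions. -/
open ContinuousMap

/-- An open cover indexed by a finite type with `N + 1` elements, on whose members `f` and `g` are
homotopic, bounds the homotopic distance by `N`. -/
theorem homotopicDistance_le_of_cover {X Y ι : Type*} [TopologicalSpace X] [TopologicalSpace Y]
    [Fintype ι] {f g : C(X, Y)} {N : ℕ} (hN : Fintype.card ι = N + 1) (U : ι → Set X)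
    (hopen : ∀ i, IsOpen (U i)) (hcover : (⋃ i, U i) = Set.univ)
    (hU : ∀ i, (f.restrict (U i)).Homotopic (g.restrict (U i))) :
    homotopicDistance f g ≤ N := by
  let e : Fin (N + 1) ≃ ι := (Fintype.equivFinOfCardEq hN).symm
  refine sInf_le ⟨N, ⟨U ∘ e, fun j => hopen _, ?_, fun j => hU _⟩, rfl⟩
  rw [← hcover]
  exact e.surjective.iUnion_comp U

/-- A finite homotopic distance is attained by an open cover. -/
theorem exists_cover_of_homotopicDistance_ne_top {X Y : Type*} [TopologicalSpace X]
    [TopologicalSpace Y] {f g : C(X, Y)} (h : homotopicDistance f g ≠ ⊤) :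
    ∃ n : ℕ, homotopicDistance f g = n ∧ ∃ U : Fin (n + 1) → Set X,
      (∀ j, IsOpen (U j)) ∧ (⋃ j, U j) = Set.univ ∧
      ∀ j, (f.restrict (U j)).Homotopic (g.restrict (U j)) := by
  have hne : ((Nat.cast : ℕ → ℕ∞) '' {n : ℕ | ∃ U : Fin (n + 1) → Set X,
      (∀ j, IsOpen (U j)) ∧ (⋃ j, U j) = Set.univ ∧
      ∀ j, (f.restrict (U j)).Homotopic (g.restrict (U j))}).Nonempty := by
    rw [Set.nonempty_iff_ne_empty]
    intro h0
    exact h (by rw [homotopicDistance, h0, sInf_empty])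
  obtain ⟨n, hn, hn'⟩ := csInf_mem hne
  exact ⟨n, hn'.symm, hn⟩

/-- Homotopies over a subset of a subspace are homotopies over its image in the whole space. -/
theorem homotopic_restrict_image_val {X Y : Type*} [TopologicalSpace X] [TopologicalSpace Y]
    {f g : C(X, Y)} {S : Set X} {V : Set S}
    (h : ((f.restrict S).restrict V).Homotopic ((g.restrict S).restrict V)) :
    (f.restrict (Subtype.val '' V)).Homotopic (g.restrict (Subtype.val '' V)) := by
  have hS (x : (Subtype.val '' V : Set X)) : (x : X) ∈ S := by
    obtain ⟨_, y, -, rfl⟩ := x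
    exact y.2
  have hV (x : (Subtype.val '' V : Set X)) : (⟨x, hS x⟩ : S) ∈ V := by
    obtain ⟨_, y, hy, rfl⟩ := x
    exact hy
  let p : C((Subtype.val '' V : Set X), V) := ⟨fun x => ⟨⟨x, hS x⟩, hV x⟩, by fun_prop⟩
  exact h.comp (ContinuousMap.Homotopic.refl p)

/-- Sub-additivity: for a finite open cover `U 0, …, U n` of `X`,
`D(f,g) ≤ Σ_k D(f|_{U k}, g|_{U k}) + n`. -/
theorem homotopicDistance_subadditive {X Y : Type*} [TopologicalSpace X] [TopologicalSpace Y]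
    (f g : C(X, Y)) (n : ℕ) (U : Fin (n + 1) → Set X)
    (hopen : ∀ k, IsOpen (U k)) (hcover : (⋃ k, U k) = Set.univ) :
    homotopicDistance f g ≤
      (∑ k : Fin (n + 1), homotopicDistance (f.restrict (U k)) (g.restrict (U k))) + (n : ℕ∞) := by
  by_cases hfin : ∀ k, homotopicDistance (f.restrict (U k)) (g.restrict (U k)) ≠ ⊤
  · choose m hm V hVo hVc hV using fun k => exists_cover_of_homotopicDistance_ne_top (hfin k)
    simp only [hm]
    have hcard : Fintype.card (Σ k, Fin (m k + 1)) = (∑ k, m k + n) + 1 := by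
      simp [Finset.sum_add_distrib, add_assoc]
    have key := homotopicDistance_le_of_cover (f := f) (g := g) hcard
      (fun i => Subtype.val '' V i.1 i.2)
      (fun i => (hopen i.1).isOpenMap_subtype_val _ (hVo i.1 i.2)) ?_
      (fun i => homotopic_restrict_image_val (hV i.1 i.2))
    · exact_mod_cast key
    · refine Set.eq_univ_of_forall fun x => ?_
      obtain ⟨k, hk⟩ := Set.mem_iUnion.mp (hcover ▸ Set.mem_univ x)
      obtain ⟨j, hj⟩ := Set.mem_iUnion.mp (hVc k ▸ Set.mem_univ (⟨x, hk⟩ : U k))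
      exact Set.mem_iUnion.mpr ⟨⟨k, j⟩, ⟨x, hk⟩, hj, rfl⟩
  · push Not at hfin
    obtain ⟨k, hk⟩ := hfin
    have hsum : ∑ k, homotopicDistance (f.restrict (U k)) (g.restrict (U k)) = ⊤ :=
      top_le_iff.mp (hk.ge.trans (Finset.single_le_sum
        (f := fun k => homotopicDistance (f.restrict (U k)) (g.restrict (U k)))
        (fun _ _ => zero_le) (Finset.mem_univ k)))
    simp [hsum]
end

section
/- Let X be a path-connected topological space with base point x_0, and let i_1, i_2 : X → X × X be the axis inclusions i_1(x) = (x, x_0) and i_2(x) = (x_0, x). Then D(i_1, i_2) = cat(X). -/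
open ContinuousMap

/-- The restrictions to `s` of the two axis inclusions are homotopic if and only if the inclusion
of `s` is null-homotopic. -/
theorem restrict_axis_inclusions_homotopic_iff {X : Type*} [TopologicalSpace X]
    [PathConnectedSpace X] (x₀ : X) (s : Set X) :
    (((ContinuousMap.id X).prodMk (ContinuousMap.const X x₀)).restrict s).Homotopic
        (((ContinuousMap.const X x₀).prodMk (ContinuousMap.id X)).restrict s) ↔
      ∃ y : X, ((ContinuousMap.id X).restrict s).Homotopic (ContinuousMap.const s y) := by
  constructor
  · intro h
    exact ⟨x₀, (Homotopic.refl ContinuousMap.fst).comp h⟩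
  · rintro ⟨y, hy⟩
    have hconst : (ContinuousMap.const s y).Homotopic (ContinuousMap.const s x₀) := by
      obtain ⟨p⟩ := PathConnectedSpace.joined y x₀
      exact ⟨⟨⟨fun q => p q.1, by fun_prop⟩, by simp, by simp⟩⟩
    have h := hy.trans hconst
    have hrefl := Homotopic.refl (ContinuousMap.const s x₀)
    exact (h.prodMk hrefl).trans (hrefl.prodMk h.symm)

/-- the homotopic distance between the two axis inclusions
`i₁ x = (x, x₀)`, `i₂ x = (x₀, x)` equals the LS-category of `X`. -/
theorem homotopicDistance_axis_inclusions_eq_lsCat (X : Type*) [TopologicalSpace X]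
    [PathConnectedSpace X] (x₀ : X) :
    homotopicDistance ((ContinuousMap.id X).prodMk (ContinuousMap.const X x₀))
      ((ContinuousMap.const X x₀).prodMk (ContinuousMap.id X)) = lsCat X := by
  simp only [homotopicDistance, lsCat, restrict_axis_inclusions_homotopic_iff]
end

section
/- For a path-connected topological space X, the topological complexity TC(X) equals the homotopic distance between the two projections p_1, p_2 : X × X → X, that is, TC(X) = D(p_1, p_2). -/
open ContinuousMap

/-- The (normalized) topological complexity of `X`: the least `n : ℕ∞` such that
`X × X` admits an open cover by `n + 1` sets over each of which the path fibration
`π : C(I, X) → X × X`, `π γ = (γ 0, γ 1)`, admits a continuous local section. -/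
noncomputable def topComplexity (X : Type*) [TopologicalSpace X] : ℕ∞ :=
  sInf ((Nat.cast : ℕ → ℕ∞) '' {n : ℕ | ∃ U : Fin (n + 1) → Set (X × X),
    (∀ j, IsOpen (U j)) ∧ (⋃ j, U j) = Set.univ ∧
    ∀ j, ∃ s : C(U j, C(unitInterval, X)),
      ∀ x : U j, s x 0 = (x : X × X).1 ∧ s x 1 = (x : X × X).2})

/-- Two continuous maps `f g : C(A, Y)` are homotopic if and only if there is a continuous family
of paths in `Y`, indexed by `A`, joining `f a` to `g a`. -/
theorem ContinuousMap.homotopic_iff_exists_curry {A Y : Type*} [TopologicalSpace A]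
    [TopologicalSpace Y] (f g : C(A, Y)) :
    f.Homotopic g ↔ ∃ s : C(A, C(unitInterval, Y)), ∀ a, s a 0 = f a ∧ s a 1 = g a := by
  constructor
  · rintro ⟨H⟩
    exact ⟨(H.toContinuousMap.comp ContinuousMap.prodSwap).curry,
      fun a => ⟨H.apply_zero a, H.apply_one a⟩⟩
  · rintro ⟨s, hs⟩
    exact ⟨{ toContinuousMap := s.uncurry.comp ContinuousMap.prodSwap
             map_zero_left := fun a => (hs a).1
             map_one_left := fun a => (hs a).2 }⟩

/-- `TC(X) = D(p₁, p₂)` for the two projections `p₁ p₂ : X × X → X`. -/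
theorem topComplexity_eq_homotopicDistance_proj (X : Type*) [TopologicalSpace X]
    [PathConnectedSpace X] :
    topComplexity X =
      homotopicDistance (ContinuousMap.fst : C(X × X, X)) (ContinuousMap.snd : C(X × X, X)) := by
  simp only [topComplexity, homotopicDistance, ContinuousMap.homotopic_iff_exists_curry,
    ContinuousMap.restrict_apply, ContinuousMap.fst_apply, ContinuousMap.snd_apply]
end

section
/- Let f, g : X → Y be continuous maps between topological spaces. Then D(f,g) equals the least integer n ≥ 0 such that X admits an open cover U_0, …, U_n where for each j there is a continuous map s_j : U_j → C([0,1], Y) (path space with the compact-open topology) satisfying s_j(x)(0) = f(x) and s_j(x)(1) = g(x) for all x ∈ U_j (i.e., D(f,g) is the sectional category of the pullback of the path fibration of Y along (f,g) : X → Y × Y). -/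
open ContinuousMap

/-- Two maps are homotopic if and only if they are the endpoints of a continuous family of paths
in the target, parametrized by the source. -/
theorem ContinuousMap.homotopic_iff_exists_pathSpace_lift {X Y : Type*} [TopologicalSpace X]
    [TopologicalSpace Y] (f g : C(X, Y)) :
    f.Homotopic g ↔
      ∃ s : C(X, C(unitInterval, Y)), ∀ x : X, s x 0 = f x ∧ s x 1 = g x := by
  constructor
  · rintro ⟨F⟩
    exact ⟨(F.toContinuousMap.comp ContinuousMap.prodSwap).curry,
      fun x => ⟨F.apply_zero x, F.apply_one x⟩⟩
  · rintro ⟨s, hs⟩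
    exact ⟨{  toContinuousMap := s.uncurry.comp ContinuousMap.prodSwap
              map_zero_left := fun x => (hs x).1
              map_one_left := fun x => (hs x).2 }⟩

/-- `D(f,g)` is the sectional category of the pullback of the path
fibration of `Y` along `(f, g) : X → Y × Y`: the least `n` such that `X` admits an
open cover `U 0, …, U n` with continuous maps `s_j : U j → C(I, Y)` satisfying
`s_j x 0 = f x` and `s_j x 1 = g x`. -/
theorem homotopicDistance_eq_secat {X Y : Type*} [TopologicalSpace X] [TopologicalSpace Y]
    (f g : C(X, Y)) :
    homotopicDistance f g =
      sInf ((Nat.cast : ℕ → ℕ∞) '' {n : ℕ | ∃ U : Fin (n + 1) → Set X,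
        (∀ j, IsOpen (U j)) ∧ (⋃ j, U j) = Set.univ ∧
        ∀ j, ∃ s : C(U j, C(unitInterval, Y)),
          ∀ x : U j, s x 0 = f (x : X) ∧ s x 1 = g (x : X)}) := by
  simp only [homotopicDistance, ContinuousMap.homotopic_iff_exists_pathSpace_lift,
    ContinuousMap.restrict_apply]
end

section
/- Let f, g : X → Y and h : Y → Z be continuous maps between topological spaces. Then D(h ∘ f, h ∘ g) ≤ D(f,g). -/
open ContinuousMap

/-- post-composition does not increase the homotopic distance. -/
theorem homotopicDistance_comp_left {X Y Z : Type*} [TopologicalSpace X] [TopologicalSpace Y]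
    [TopologicalSpace Z] (f g : C(X, Y)) (h : C(Y, Z)) :
    homotopicDistance (h.comp f) (h.comp g) ≤ homotopicDistance f g := by
  refine sInf_le_sInf (Set.image_mono ?_)
  rintro n ⟨U, hU, hcover, hfg⟩
  exact ⟨U, hU, hcover, fun j => (Homotopic.refl h).comp (hfg j)⟩
end

section
/- Let f, g : X → Y and h : Z → X be continuous maps between topological spaces. Then D(f ∘ h, g ∘ h) ≤ D(f,g). -/
open ContinuousMap

/-- pre-composition does not increase the homotopic distance. -/
theorem homotopicDistance_comp_right {X Y Z : Type*} [TopologicalSpace X] [TopologicalSpace Y]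
    [TopologicalSpace Z] (f g : C(X, Y)) (h : C(Z, X)) :
    homotopicDistance (f.comp h) (g.comp h) ≤ homotopicDistance f g := by
  refine le_sInf ?_
  rintro _ ⟨n, ⟨U, hU, hcover, hfg⟩, rfl⟩
  refine sInf_le ⟨n, ⟨fun j => h ⁻¹' U j, fun j => (hU j).preimage h.continuous, ?_, ?_⟩, rfl⟩
  · rw [← Set.preimage_iUnion, hcover, Set.preimage_univ]
  · exact fun j => (hfg j).comp (.refl (h.restrictPreimage (U j)))
end

section
/- Let f, g : X → Y be continuous maps, let y_0 ∈ Y, let X_0 = g^{-1}(y_0) be the fiber of g over y_0, and let f_0 = f|_{X_0} : X_0 → Y be the restriction of f. Then D(f_0, c) ≤ D(f,g), where c : X_0 → Y is the constant map with value y_0. -/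
open ContinuousMap

/-- Pulling back along `φ` does not increase the homotopic distance. -/
theorem homotopicDistance_comp_right_le {X Y Z : Type*} [TopologicalSpace X]
    [TopologicalSpace Y] [TopologicalSpace Z] (f g : C(X, Y)) (φ : C(Z, X)) :
    homotopicDistance (f.comp φ) (g.comp φ) ≤ homotopicDistance f g := by
  refine sInf_le_sInf (Set.image_mono ?_)
  rintro n ⟨U, hU, hcov, hhom⟩
  refine ⟨fun j => φ ⁻¹' U j, fun j => (hU j).preimage φ.continuous, ?_, fun j => ?_⟩
  · rw [← Set.preimage_iUnion, hcov, Set.preimage_univ]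
  · exact (hhom j).comp (.refl (φ.restrictPreimage (U j)))

/-- if `X₀ = g⁻¹ y₀` and `f₀ = f|_{X₀}`, then `D(f₀, y₀) ≤ D(f, g)`. -/
theorem homotopicDistance_restrict_fiber_le {X Y : Type*} [TopologicalSpace X]
    [TopologicalSpace Y] (f g : C(X, Y)) (y₀ : Y) :
    homotopicDistance (f.restrict (⇑g ⁻¹' {y₀}))
        (ContinuousMap.const (⇑g ⁻¹' {y₀} : Set X) y₀) ≤
      homotopicDistance f g := by
  have hconst : g.comp (ContinuousMap.restrict (⇑g ⁻¹' {y₀}) (.id X)) =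
      ContinuousMap.const (⇑g ⁻¹' {y₀} : Set X) y₀ :=
    ContinuousMap.ext fun x => x.2
  rw [← hconst]
  exact homotopicDistance_comp_right_le f g (ContinuousMap.restrict (⇑g ⁻¹' {y₀}) (.id X))
end

section
/- Let h, h' : Z → X and f, g : X → Y be continuous maps such that f ∘ h' is homotopic to g ∘ h'. Then D(f ∘ h, g ∘ h) ≤ D(h, h'). -/
open ContinuousMap

/-- if `f ∘ h' ≃ g ∘ h'` then `D(f ∘ h, g ∘ h) ≤ D(h, h')`. -/
theorem homotopicDistance_comp_le_of_homotopic {X Y Z : Type*} [TopologicalSpace X]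
    [TopologicalSpace Y] [TopologicalSpace Z] (h h' : C(Z, X)) (f g : C(X, Y))
    (hyp : (f.comp h').Homotopic (g.comp h')) :
    homotopicDistance (f.comp h) (g.comp h) ≤ homotopicDistance h h' := by
  refine sInf_le_sInf (Set.image_mono ?_)
  rintro n ⟨U, hopen, hcover, hU⟩
  refine ⟨U, hopen, hcover, fun j => ?_⟩
  have comp_restrict (k : C(X, Y)) :
      ((k.comp h).restrict (U j)).Homotopic ((k.comp h').restrict (U j)) :=
    (Homotopic.refl k).comp (hU j)
  have hyp_restrict :
      ((f.comp h').restrict (U j)).Homotopic ((g.comp h').restrict (U j)) :=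
    hyp.comp (Homotopic.refl ((ContinuousMap.id Z).restrict (U j)))
  exact ((comp_restrict f).trans hyp_restrict).trans (comp_restrict g).symm
end

section
/- Let f, g : X → Y be continuous maps with path-connected domain X and path-connected codomain Y. Then D(f, g) ≤ cat(X). -/
open ContinuousMap

/-- Maps into a path-connected space are homotopic on every set whose inclusion is null-homotopic. -/
theorem homotopic_restrict_of_nullhomotopic {X Y : Type*} [TopologicalSpace X]
    [TopologicalSpace Y] [PathConnectedSpace Y] (f g : C(X, Y)) {U : Set X} {y : X}
    (h : ((ContinuousMap.id X).restrict U).Homotopic (ContinuousMap.const U y)) :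
    (f.restrict U).Homotopic (g.restrict U) := by
  have hf : (f.restrict U).Homotopic (ContinuousMap.const U (f y)) :=
    (ContinuousMap.Homotopic.refl f).comp h
  have hg : (g.restrict U).Homotopic (ContinuousMap.const U (g y)) :=
    (ContinuousMap.Homotopic.refl g).comp h
  have hc : (ContinuousMap.const U (f y)).Homotopic (ContinuousMap.const U (g y)) :=
    ⟨{ toFun := fun p => PathConnectedSpace.somePath (f y) (g y) p.1
       map_zero_left := by simp
       map_one_left := by simp }⟩
  exact hf.trans (hc.trans hg.symm)

/-- `D(f, g) ≤ cat(X)` for maps with path-connected domain and codomain. -/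
theorem homotopicDistance_le_lsCat {X Y : Type*} [TopologicalSpace X] [TopologicalSpace Y]
    [PathConnectedSpace X] [PathConnectedSpace Y] (f g : C(X, Y)) :
    homotopicDistance f g ≤ lsCat X := by
  refine sInf_le_sInf (Set.image_mono ?_)
  rintro n ⟨U, hopen, hcover, hnull⟩
  exact ⟨U, hopen, hcover, fun j =>
    (hnull j).elim fun _ h => homotopic_restrict_of_nullhomotopic f g h⟩
end

section
/- Let f, g : X → Y be continuous maps between topological spaces. Then D(f,g) ≤ TC(Y). -/
open ContinuousMap

/-- Precomposition with a continuous map does not increase the homotopic distance. -/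
theorem homotopicDistance_comp_le {X Y Z : Type*} [TopologicalSpace X] [TopologicalSpace Y]
    [TopologicalSpace Z] (f g : C(Y, Z)) (h : C(X, Y)) :
    homotopicDistance (f.comp h) (g.comp h) ≤ homotopicDistance f g := by
  refine sInf_le_sInf (Set.image_mono ?_)
  rintro n ⟨U, hUo, hUc, hU⟩
  refine ⟨fun j => h ⁻¹' U j, fun j => (hUo j).preimage h.continuous, ?_, fun j => ?_⟩
  · rw [← Set.preimage_iUnion, hUc, Set.preimage_univ]
  · exact (hU j).comp (.refl (h.restrictPreimage (U j)))

/-- `D(f,g) ≤ TC(Y)`, where `TC(Y) = D(p₁, p₂)`. -/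
theorem homotopicDistance_le_TC_codomain {X Y : Type*} [TopologicalSpace X] [TopologicalSpace Y]
    (f g : C(X, Y)) :
    homotopicDistance f g ≤
      homotopicDistance (ContinuousMap.fst : C(Y × Y, Y)) (ContinuousMap.snd : C(Y × Y, Y)) := by
  exact homotopicDistance_comp_le ContinuousMap.fst ContinuousMap.snd (f.prodMk g)
end

section
/- Let f, g : X → Y be continuous maps and let α : Y → Y' be a continuous map admitting a left homotopy inverse (i.e., there is a continuous β : Y' → Y with β ∘ α homotopic to id_Y). Then D(α ∘ f, α ∘ g) = D(f, g). -/
open ContinuousMap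

theorem ContinuousMap.homotopic_comp_iff_of_left_homotopy_inverse {W Y Y' : Type*}
    [TopologicalSpace W] [TopologicalSpace Y] [TopologicalSpace Y'] {α : C(Y, Y')}
    (hα : ∃ β : C(Y', Y), (β.comp α).Homotopic (ContinuousMap.id Y)) (f g : C(W, Y)) :
    (α.comp f).Homotopic (α.comp g) ↔ f.Homotopic g := by
  refine ⟨fun h => ?_, fun h => (Homotopic.refl α).comp h⟩
  obtain ⟨β, hβ⟩ := hα
  exact (hβ.comp (.refl f)).symm.trans
    (((Homotopic.refl β).comp h).trans (hβ.comp (.refl g)))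

/-- composing with a map having a left homotopy inverse preserves the
homotopic distance. -/
theorem homotopicDistance_comp_left_homotopy_inverse {X Y Y' : Type*} [TopologicalSpace X]
    [TopologicalSpace Y] [TopologicalSpace Y'] (f g : C(X, Y)) (α : C(Y, Y'))
    (hα : ∃ β : C(Y', Y), (β.comp α).Homotopic (ContinuousMap.id Y)) :
    homotopicDistance (α.comp f) (α.comp g) = homotopicDistance f g := by
  have key (s : Set X) : ((α.comp f).restrict s).Homotopic ((α.comp g).restrict s) ↔
      (f.restrict s).Homotopic (g.restrict s) :=
    homotopic_comp_iff_of_left_homotopy_inverse hα (f.restrict s) (g.restrict s)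
  simp only [homotopicDistance, key]
end

section
/- Let G be a path-connected topological space equipped with continuous maps μ : G × G → G (multiplication) and δ : G × G → G (division) and a point x_0 ∈ G such that μ ∘ (p_1, δ) is homotopic to p_2 (where p_1, p_2 : G × G → G are the projections and (p_1, δ)(x,y) = (p_1(x,y), δ(x,y))) and the map x ↦ μ(x, x_0) is homotopic to id_G (i.e., G is an H-space). Then for any pair of continuous maps f, g : G × G → G one has D(f, g) ≤ cat(G). -/
open ContinuousMap

/-- In an H-space with division, two maps into `G` are homotopic as soon as their quotient is
null-homotopic. -/
theorem homotopic_of_nullhomotopic_div {X G : Type*} [TopologicalSpace X] [TopologicalSpace G]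
    [PathConnectedSpace G] (μ δ : C(G × G, G)) (x₀ : G)
    (hdiv : (μ.comp ((ContinuousMap.fst : C(G × G, G)).prodMk δ)).Homotopic
      (ContinuousMap.snd : C(G × G, G)))
    (hunit : (μ.comp ((ContinuousMap.id G).prodMk (ContinuousMap.const G x₀))).Homotopic
      (ContinuousMap.id G))
    (f g : C(X, G)) (y : G)
    (hfg : (δ.comp (f.prodMk g)).Homotopic (ContinuousMap.const X y)) :
    f.Homotopic g := by
  have hy : (ContinuousMap.const X y).Homotopic (ContinuousMap.const X x₀) :=
    (ContinuousMap.homotopic_const_iff (Y := Unit).mpr (PathConnectedSpace.joined y x₀)).comp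
      (ContinuousMap.Homotopic.refl (ContinuousMap.const X ()))
  have hquot : (μ.comp (f.prodMk (δ.comp (f.prodMk g)))).Homotopic g :=
    hdiv.comp (ContinuousMap.Homotopic.refl (f.prodMk g))
  have hright : (μ.comp (f.prodMk (ContinuousMap.const X x₀))).Homotopic f :=
    hunit.comp (ContinuousMap.Homotopic.refl f)
  have hmid : (μ.comp (f.prodMk (δ.comp (f.prodMk g)))).Homotopic
      (μ.comp (f.prodMk (ContinuousMap.const X x₀))) :=
    (ContinuousMap.Homotopic.refl μ).comp
      ((ContinuousMap.Homotopic.refl f).prodMk (hfg.trans hy))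
  exact hright.symm.trans (hmid.symm.trans hquot)

/-- if `G` is a path-connected H-space (with multiplication `μ`, division
`δ` and identity `x₀` such that `μ ∘ (p₁, δ) ≃ p₂` and `μ(-, x₀) ≃ id`), then
`D(f, g) ≤ cat(G)` for any pair of maps `f g : G × G → G`. -/
theorem homotopicDistance_le_lsCat_of_Hspace {G : Type*} [TopologicalSpace G]
    [PathConnectedSpace G] (μ δ : C(G × G, G)) (x₀ : G)
    (hdiv : (μ.comp ((ContinuousMap.fst : C(G × G, G)).prodMk δ)).Homotopic
      (ContinuousMap.snd : C(G × G, G)))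
    (hunit : (μ.comp ((ContinuousMap.id G).prodMk (ContinuousMap.const G x₀))).Homotopic
      (ContinuousMap.id G))
    (f g : C(G × G, G)) :
    homotopicDistance f g ≤ lsCat G := by
  refine sInf_le_sInf (Set.image_mono ?_)
  rintro n ⟨U, hopen, hcover, hnull⟩
  set h : C(G × G, G) := δ.comp (f.prodMk g)
  refine ⟨fun j => h ⁻¹' U j, fun j => (hopen j).preimage h.continuous, ?_, fun j => ?_⟩
  · rw [← Set.preimage_iUnion, hcover, Set.preimage_univ]
  · obtain ⟨y, hy⟩ := hnull j
    refine homotopic_of_nullhomotopic_div μ δ x₀ hdiv hunit _ _ y ?_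
    exact hy.comp (ContinuousMap.Homotopic.refl (h.restrictPreimage (U j)))
end
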